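/- (Joint concavity/concavity of fidelity over convex combinations) Let ρ₁,…,ρ_k and σ₁,…,σ_k be quantum states on a finite-dimensional Hilbert space and p₁,…,p_k ≥ 0 with Σᵢ pᵢ = 1. Then F(Σᵢ pᵢρᵢ, Σᵢ pᵢσᵢ) ≥ Σᵢ pᵢ F(ρᵢ, σᵢ). -/

import Mathlib

open Matrix
open scoped Kronecker ComplexOrder

noncomputable section

def mfun {n : Type*} [Fintype n] [DecidableEq n] (f : ℝ → ℝ) (A : Matrix n n ℂ) : Matrix n n ℂ :=
  if h : A.IsHermitian then
    h.eigenvectorUnitary.1 * Matrix.diagonal (fun i => (f (h.eigenvalues i) : ℂ)) *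
      (star h.eigenvectorUnitary.1)
  else 0

def psqrt {n : Type*} [Fintype n] [DecidableEq n] (A : Matrix n n ℂ) : Matrix n n ℂ :=
  mfun Real.sqrt A

def mlog {n : Type*} [Fintype n] [DecidableEq n] (A : Matrix n n ℂ) : Matrix n n ℂ :=
  mfun Real.log A

def traceNorm {n : Type*} [Fintype n] [DecidableEq n] (A : Matrix n n ℂ) : ℝ :=
  ((psqrt (Aᴴ * A)).trace).re

def fid {n : Type*} [Fintype n] [DecidableEq n] (ρ σ : Matrix n n ℂ) : ℝ :=
  traceNorm (psqrt ρ * psqrt σ)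

def vNEntropy {n : Type*} [Fintype n] [DecidableEq n] (A : Matrix n n ℂ) : ℝ :=
  - ((A * mlog A).trace).re

def relEnt {n : Type*} [Fintype n] [DecidableEq n] (ρ σ : Matrix n n ℂ) : ℝ :=
  ((ρ * mlog ρ).trace - (ρ * mlog σ).trace).re

theorem mfun_mul {n : Type*} [Fintype n] [DecidableEq n] (f g : ℝ → ℝ) (A : Matrix n n ℂ) :
    mfun f A * mfun g A = mfun (fun x => f x * g x) A := by
  unfold mfun
  split_ifs with h
  · have hU : star h.eigenvectorUnitary.1 * h.eigenvectorUnitary.1 = 1 :=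
      Unitary.coe_star_mul_self _
    calc _ = h.eigenvectorUnitary.1 * diagonal (fun i => (f (h.eigenvalues i) : ℂ)) *
          (star h.eigenvectorUnitary.1 * h.eigenvectorUnitary.1) *
          diagonal (fun i => (g (h.eigenvalues i) : ℂ)) * star h.eigenvectorUnitary.1 := by
            simp only [mul_assoc]
      _ = _ := by
        rw [hU, mul_one, mul_assoc _ (diagonal _) (diagonal _), diagonal_mul_diagonal]
        simp only [Complex.ofReal_mul]
  · simp

theorem mfun_isHermitian {n : Type*} [Fintype n] [DecidableEq n] (f : ℝ → ℝ)
    (A : Matrix n n ℂ) : (mfun f A).IsHermitian := by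
  unfold mfun
  split_ifs with h
  · refine isHermitian_mul_mul_conjTranspose _ ?_
    exact isHermitian_diagonal_of_self_adjoint _ (by ext i; simp)
  · exact isHermitian_zero

theorem mfun_posSemidef {n : Type*} [Fintype n] [DecidableEq n] {f : ℝ → ℝ}
    (hf : ∀ x, 0 ≤ f x) (A : Matrix n n ℂ) : (mfun f A).PosSemidef := by
  unfold mfun
  split_ifs with h
  · refine PosSemidef.mul_mul_conjTranspose_same (posSemidef_diagonal_iff.2 fun i => ?_) _
    exact_mod_cast hf _
  · exact PosSemidef.zero

theorem mfun_eq_self {n : Type*} [Fintype n] [DecidableEq n] {f : ℝ → ℝ} {A : Matrix n n ℂ}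
    (h : A.IsHermitian) (hf : ∀ i, f (h.eigenvalues i) = h.eigenvalues i) : mfun f A = A := by
  unfold mfun
  rw [dif_pos h]
  conv_rhs => rw [h.spectral_theorem, Unitary.conjStarAlgAut_apply]
  simp only [hf]
  rfl

theorem psqrt_posSemidef {n : Type*} [Fintype n] [DecidableEq n] (A : Matrix n n ℂ) :
    (psqrt A).PosSemidef :=
  mfun_posSemidef Real.sqrt_nonneg A

theorem psqrt_mul_self {n : Type*} [Fintype n] [DecidableEq n] {A : Matrix n n ℂ}
    (hA : A.PosSemidef) : psqrt A * psqrt A = A := by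
  unfold psqrt
  rw [mfun_mul]
  exact mfun_eq_self hA.1 fun i => Real.mul_self_sqrt (hA.eigenvalues_nonneg i)

/-- A family `M` with `∑ Mᵢᴴ Mᵢ = A²` factors through `A` by a partial isometry. -/
theorem exists_partialIsometry_factor {n ι : Type*} [Fintype n] [DecidableEq n] [Fintype ι]
    {A : Matrix n n ℂ} (hA : A.IsHermitian) (M : ι → Matrix n n ℂ)
    (hM : ∑ i, (M i)ᴴ * M i = A * A) :
    ∃ (V : ι → Matrix n n ℂ) (P : Matrix n n ℂ), P.IsHermitian ∧ P * P = P ∧ P * A = A ∧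
      (∀ i, M i = V i * A) ∧ (∀ i, V i * P = V i) ∧ ∑ i, (V i)ᴴ * V i = P := by
  set G := mfun (fun x => x⁻¹) A with hG
  have hGH : Gᴴ = G := mfun_isHermitian _ A
  have hAid : mfun (fun x => x) A = A := mfun_eq_self hA fun _ => rfl
  have hGA : G * A = mfun (fun x => x⁻¹ * x) A := by
    conv_lhs => rhs; rw [← hAid]
    rw [hG, mfun_mul]
  have hAG : A * G = mfun (fun x => x * x⁻¹) A := by
    conv_lhs => lhs; rw [← hAid]
    rw [hG, mfun_mul]
  have hcomm : G * A = A * G := by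
    simp only [hGA, hAG, mul_comm]
  have hAGA : A * G * A = A := by
    conv_lhs => rw [hAG]; rhs; rw [← hAid]
    rw [mfun_mul]
    simpa only [mul_inv_mul_cancel] using hAid
  have hGAG : G * A * G = G := by
    rw [hGA, hG, mfun_mul]
    congr! 2 with x
    simpa using mul_inv_mul_cancel x⁻¹
  have hAA : Aᴴ = A := hA
  have hPP : G * A * (G * A) = G * A := by rw [← mul_assoc, hGAG]
  have hPH : (G * A)ᴴ = G * A := by rw [conjTranspose_mul, hGH, hAA, hcomm]
  refine ⟨fun i => M i * G, G * A, hPH, hPP, by rw [hcomm, hAGA], fun i => ?_, fun i => ?_, ?_⟩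
  · have hsum : ∑ j, ((M j * (1 - G * A))ᴴ * (M j * (1 - G * A))) = 0 := by
      have : ∀ j, (M j * (1 - G * A))ᴴ * (M j * (1 - G * A)) =
          (1 - G * A)ᴴ * ((M j)ᴴ * M j) * (1 - G * A) := fun j => by
        simp only [conjTranspose_mul, mul_assoc]
      simp only [this]
      rw [← Finset.sum_mul, ← Finset.mul_sum, hM]
      have : A * (1 - G * A) = 0 := by rw [mul_sub, mul_one, ← mul_assoc, hAGA, sub_self]
      rw [mul_assoc, mul_assoc, this, mul_zero, mul_zero]
    have htr := congrArg trace hsum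
    rw [trace_sum, trace_zero, Finset.sum_eq_zero_iff_of_nonneg
      fun j _ => (posSemidef_conjTranspose_mul_self _).trace_nonneg] at htr
    have := trace_conjTranspose_mul_self_eq_zero_iff.1 (htr i (Finset.mem_univ i))
    rw [mul_sub, mul_one, sub_eq_zero] at this
    rw [mul_assoc]
    exact this
  · simp only [mul_assoc] at hGAG ⊢
    rw [hcomm, hGAG]
  · have : ∀ j, (M j * G)ᴴ * (M j * G) = G * ((M j)ᴴ * M j) * G := fun j => by
      simp only [conjTranspose_mul, mul_assoc, hGH]
    simp only [this]
    rw [← Finset.sum_mul, ← Finset.mul_sum, hM, ← mul_assoc, mul_assoc, ← hcomm, hPP]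

theorem posSemidef_one_sub_of_isIdempotent {n : Type*} [Fintype n] [DecidableEq n]
    {P : Matrix n n ℂ} (hP : P.IsHermitian) (hPP : P * P = P) : (1 - P).PosSemidef := by
  have h := posSemidef_conjTranspose_mul_self (1 - P)
  rwa [conjTranspose_sub, hP.eq, conjTranspose_one, mul_sub, mul_one, sub_mul, one_mul, hPP,
    sub_self, sub_zero] at h

theorem exists_polar {n : Type*} [Fintype n] [DecidableEq n] (T : Matrix n n ℂ) :
    ∃ Q : Matrix n n ℂ, T = Q * psqrt (Tᴴ * T) ∧ psqrt (Tᴴ * T) = Qᴴ * T ∧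
      (1 - Q * Qᴴ).PosSemidef := by
  obtain ⟨V, P, -, hPP, hPA, hM, hVP, hV⟩ :=
    exists_partialIsometry_factor (psqrt_posSemidef (Tᴴ * T)).1 (fun _ : Unit => T)
      (by simp [psqrt_mul_self (posSemidef_conjTranspose_mul_self T)])
  have hT : T = V () * psqrt (Tᴴ * T) := hM ()
  have hV' : (V ())ᴴ * V () = P := by simpa using hV
  refine ⟨V (), hT, ?_, ?_⟩
  · conv_rhs => rw [hT]
    rw [← mul_assoc, hV', hPA]
  · refine posSemidef_one_sub_of_isIdempotent (isHermitian_mul_conjTranspose_self _) ?_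
    rw [mul_assoc, ← mul_assoc _ (V ()), hV', ← mul_assoc, hVP]

theorem re_trace_mul_nonneg {n : Type*} [Fintype n] [DecidableEq n] {A B : Matrix n n ℂ}
    (hA : A.PosSemidef) (hB : B.PosSemidef) : 0 ≤ (A * B).trace.re := by
  have h := (hA.mul_mul_conjTranspose_same (psqrt B)).trace_nonneg
  rw [(psqrt_posSemidef B).1.eq, trace_mul_comm, ← mul_assoc, psqrt_mul_self hB, trace_mul_comm] at h
  exact (Complex.nonneg_iff.1 h).1

theorem re_trace_mul_le {n : Type*} [Fintype n] [DecidableEq n] {C R : Matrix n n ℂ}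
    (hC : (1 - C).PosSemidef) (hR : R.PosSemidef) : (C * R).trace.re ≤ R.trace.re := by
  have h := re_trace_mul_nonneg hC hR
  rw [sub_mul, one_mul, trace_sub, Complex.sub_re] at h
  linarith

theorem two_mul_re_trace_le {n : Type*} [Fintype n] [DecidableEq n] (X Y : Matrix n n ℂ)
    {R : Matrix n n ℂ} (hR : R.PosSemidef) :
    2 * (Xᴴ * Y * R).trace.re ≤ (Xᴴ * X * R).trace.re + (Yᴴ * Y * R).trace.re := by
  have h := re_trace_mul_nonneg (posSemidef_conjTranspose_mul_self (X - Y)) hR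
  have hconj : (Yᴴ * X * R).trace.re = (Xᴴ * Y * R).trace.re := by
    have : (Yᴴ * X * R).trace = star (Xᴴ * Y * R).trace := by
      rw [← trace_conjTranspose, conjTranspose_mul, conjTranspose_mul, conjTranspose_conjTranspose,
        hR.1.eq, trace_mul_comm]
    rw [this]
    simp
  simp only [conjTranspose_sub, sub_mul, mul_sub, trace_sub, Complex.sub_re] at h
  linarith

theorem trace_conj_sandwich {n : Type*} [Fintype n] (X Y R : Matrix n n ℂ) :
    ((X * Y)ᴴ * (X * Y) * R).trace = (Xᴴ * X * (Y * R * Yᴴ)).trace := by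
  rw [conjTranspose_mul, mul_assoc, mul_assoc, trace_mul_comm]
  simp only [mul_assoc]

theorem sum_sqrt_smul_psqrt {n ι : Type*} [Fintype n] [DecidableEq n] [Fintype ι]
    {ρ : ι → Matrix n n ℂ} {p : ι → ℝ} (hρ : ∀ i, (ρ i).PosSemidef) (hp : ∀ i, 0 ≤ p i) :
    ∑ i, (√(p i) • psqrt (ρ i))ᴴ * (√(p i) • psqrt (ρ i)) =
      psqrt (∑ i, p i • ρ i) * psqrt (∑ i, p i • ρ i) := by
  rw [psqrt_mul_self (posSemidef_sum _ fun i _ => (hρ i).smul (hp i))]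
  refine Finset.sum_congr rfl fun i _ => ?_
  rw [conjTranspose_smul, (psqrt_posSemidef (ρ i)).1.eq, smul_mul_smul_comm,
    psqrt_mul_self (hρ i), star_trivial, Real.mul_self_sqrt (hp i)]

/-- joint concavity of fidelity:
F(Σᵢ pᵢρᵢ, Σᵢ pᵢσᵢ) ≥ Σᵢ pᵢ F(ρᵢ, σᵢ) for states ρᵢ, σᵢ and a probability vector p. -/
theorem stmt7 {n : Type*} [Fintype n] [DecidableEq n] {k : ℕ}
    (ρ σ : Fin k → Matrix n n ℂ) (p : Fin k → ℝ)
    (hρ : ∀ i, (ρ i).PosSemidef) (hσ : ∀ i, (σ i).PosSemidef)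
    (hρ1 : ∀ i, (ρ i).trace = 1) (hσ1 : ∀ i, (σ i).trace = 1)
    (hpnn : ∀ i, 0 ≤ p i) (hp1 : ∑ i, p i = 1) :
    ∑ i, p i * fid (ρ i) (σ i) ≤ fid (∑ i, p i • ρ i) (∑ i, p i • σ i) := by
  obtain ⟨V, P, hP, hPP, -, hM, -, hV⟩ := exists_partialIsometry_factor
    (psqrt_posSemidef (∑ i, p i • ρ i)).1 _ (sum_sqrt_smul_psqrt hρ hpnn)
  obtain ⟨W, P', hP', hPP', -, hN, -, hW⟩ := exists_partialIsometry_factor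
    (psqrt_posSemidef (∑ i, p i • σ i)).1 _ (sum_sqrt_smul_psqrt hσ hpnn)
  unfold fid traceNorm
  set A := psqrt (∑ i, p i • ρ i)
  set B := psqrt (∑ i, p i • σ i)
  have hBH : Bᴴ = B := (psqrt_posSemidef _).1
  obtain ⟨Q, hQ, hQ', hQQ⟩ := exists_polar (A * B)
  have hR : (psqrt ((A * B)ᴴ * (A * B))).PosSemidef := psqrt_posSemidef _
  set R := psqrt ((A * B)ᴴ * (A * B))
  have hQR : (Q * R * Qᴴ).trace = R.trace := by
    rw [trace_mul_comm, ← hQ, ← hQ']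
  choose U _ hU hUU using fun i => exists_polar (psqrt (ρ i) * psqrt (σ i))
  have key : ∀ i, 2 * (p i * (psqrt ((psqrt (ρ i) * psqrt (σ i))ᴴ *
      (psqrt (ρ i) * psqrt (σ i)))).trace.re) ≤
      ((W i)ᴴ * W i * R).trace.re + ((V i)ᴴ * V i * (Q * R * Qᴴ)).trace.re := by
    intro i
    have hN' : √(p i) • psqrt (σ i) = B * (W i)ᴴ := by
      rw [← hBH, ← conjTranspose_mul, ← hN i, conjTranspose_smul, star_trivial,
        (psqrt_posSemidef (σ i)).1.eq]
    have h1 : p i • (psqrt ((psqrt (ρ i) * psqrt (σ i))ᴴ *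
        (psqrt (ρ i) * psqrt (σ i)))).trace = ((W i)ᴴ * ((U i)ᴴ * (V i * Q)) * R).trace := by
      rw [hU i, ← trace_smul, ← mul_smul_comm]
      nth_rw 1 [← Real.mul_self_sqrt (hpnn i)]
      rw [← smul_mul_smul_comm, hM i, hN', mul_assoc (V i), ← mul_assoc A, hQ, ← mul_assoc,
        ← mul_assoc, trace_mul_comm]
      simp only [mul_assoc]
    have h2 := two_mul_re_trace_le (W i) ((U i)ᴴ * (V i * Q)) hR
    rw [← h1, Complex.smul_re, smul_eq_mul, trace_conj_sandwich (U i)ᴴ,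
      conjTranspose_conjTranspose] at h2
    have h3 := re_trace_mul_le (hUU i) (hR.mul_mul_conjTranspose_same (V i * Q))
    have h4 : (V i * Q * R * (V i * Q)ᴴ).trace = ((V i)ᴴ * V i * (Q * R * Qᴴ)).trace := by
      rw [← trace_conj_sandwich, trace_mul_comm, ← mul_assoc, trace_mul_comm]
    rw [h4] at h3
    linarith
  have hsum := Finset.sum_le_sum fun i (_ : i ∈ Finset.univ) => key i
  rw [Finset.sum_add_distrib, ← Finset.mul_sum, ← Complex.re_sum, ← Complex.re_sum, ← trace_sum,
    ← trace_sum, ← Finset.sum_mul, ← Finset.sum_mul, hV, hW] at hsum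
  have e1 := re_trace_mul_le (posSemidef_one_sub_of_isIdempotent hP' hPP') hR
  have e2 := re_trace_mul_le (posSemidef_one_sub_of_isIdempotent hP hPP)
    (hR.mul_mul_conjTranspose_same Q)
  rw [hQR] at e2
  linarith
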